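/- arXiv:1412.3881 — 2 statements merged into one kernel-verified Lean document; each statement's English description precedes it below -/
import Mathlib

section
/- Let G be a finite simple graph on a vertex set V. Then ind-match(G) = min-match(G) if and only if there exist non-negative integers α, β, γ and a partition V = {v_{i1}, v_{i2} : i = 1, …, α+β} ⊔ {z_1, …, z_α} ⊔ {w_1, …, w_γ} such that the edge set of G equals {e_i : i = 1, …, α+β} ∪ {e_i' : i = 1, …, α} ∪ E', where e_i = {v_{i1}, v_{i2}} for i = 1, …, α+β, e_i' = {v_{i1}, z_i} for i = 1, …, α, and every edge in E' is of one of the following types: (i) an edge containing some z_i (1 ≤ i ≤ α); (ii) an edge consisting of an endpoint of e_i for some i with α+1 ≤ i ≤ α+β and some w_j (1 ≤ j ≤ γ); (iii) an edge consisting of v_{i1} for some i with 1 ≤ i ≤ α and some w_j (1 ≤ j ≤ γ). -/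
namespace DIM

open SimpleGraph

variable {V : Type*}

/-- `M` is a matching of `G`: a set of edges of `G` that are pairwise disjoint. -/
def IsMatching (G : SimpleGraph V) (M : Set (Sym2 V)) : Prop :=
  M ⊆ G.edgeSet ∧ ∀ e ∈ M, ∀ e' ∈ M, e ≠ e' → ∀ v : V, v ∈ e → v ∉ e'

/-- A maximal matching: a matching not properly contained in any other matching. -/
def IsMaximalMatching (G : SimpleGraph V) (M : Set (Sym2 V)) : Prop :=
  IsMatching G M ∧ ∀ M' : Set (Sym2 V), IsMatching G M' → M ⊆ M' → M' = M

/-- Two edges `e`, `e'` are 3-disjoint in `G`: they are disjoint and no edge `f` of `G`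
meets both. -/
def ThreeDisjoint (G : SimpleGraph V) (e e' : Sym2 V) : Prop :=
  (∀ v : V, v ∈ e → v ∉ e') ∧
    ∀ f ∈ G.edgeSet, ¬((∃ v, v ∈ f ∧ v ∈ e) ∧ (∃ v, v ∈ f ∧ v ∈ e'))

/-- An induced matching of `G`: a set of edges of `G` that are pairwise 3-disjoint. -/
def IsInducedMatching (G : SimpleGraph V) (M : Set (Sym2 V)) : Prop :=
  M ⊆ G.edgeSet ∧ ∀ e ∈ M, ∀ e' ∈ M, e ≠ e' → ThreeDisjoint G e e'

/-- `match(G)`: the maximum cardinality of a matching of `G`. -/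
noncomputable def matchNum (G : SimpleGraph V) : ℕ :=
  sSup {n | ∃ M : Set (Sym2 V), IsMatching G M ∧ M.ncard = n}

/-- `min-match(G)`: the minimum cardinality of a maximal matching of `G`. -/
noncomputable def minMatchNum (G : SimpleGraph V) : ℕ :=
  sInf {n | ∃ M : Set (Sym2 V), IsMaximalMatching G M ∧ M.ncard = n}

/-- `ind-match(G)`: the maximum cardinality of an induced matching of `G`. -/
noncomputable def indMatchNum (G : SimpleGraph V) : ℕ :=
  sSup {n | ∃ M : Set (Sym2 V), IsInducedMatching G M ∧ M.ncard = n}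

/-- A dominating induced matching: an induced matching that is also a maximal matching. -/
def IsDIM (G : SimpleGraph V) (M : Set (Sym2 V)) : Prop :=
  IsInducedMatching G M ∧ IsMaximalMatching G M

/-- `S` is an independent set of `G`. -/
def IsIndepSet (G : SimpleGraph V) (S : Set V) : Prop :=
  ∀ a ∈ S, ∀ b ∈ S, ¬G.Adj a b

/-- `C` is a vertex cover of `G`. -/
def IsVertexCover (G : SimpleGraph V) (C : Set V) : Prop :=
  ∀ ⦃u w : V⦄, G.Adj u w → u ∈ C ∨ w ∈ C

/-- `C` is a minimal vertex cover of `G`. -/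
def IsMinimalVertexCover (G : SimpleGraph V) (C : Set V) : Prop :=
  IsVertexCover G C ∧ ∀ C' ⊆ C, IsVertexCover G C' → C' = C

/-- `G` is unmixed: all minimal vertex covers of `G` have the same cardinality. -/
def Unmixed (G : SimpleGraph V) : Prop :=
  ∀ C C' : Set V, IsMinimalVertexCover G C → IsMinimalVertexCover G C' →
    C.ncard = C'.ncard

/-- The degree of a vertex, as the cardinality of its neighbourhood. -/
noncomputable def deg (G : SimpleGraph V) (v : V) : ℕ := (G.neighborSet v).ncard

/-- A decomposition `V = W ⊔ M` exhibiting a dominating induced matching of `G`: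
`W` is an independent set, the complement of `W` is the (injective) family of vertices
`x j k` (`j : Fin m`, `k : Fin 2`), each pair `{x j 0, x j 1}` is an edge of `G`, and the
induced subgraph on the complement of `W` consists exactly of these `m` disjoint edges. -/
def IsDimDecomp (G : SimpleGraph V) (W : Set V) {m : ℕ} (x : Fin m → Fin 2 → V) : Prop :=
  Function.Injective (fun p : Fin m × Fin 2 => x p.1 p.2) ∧
  (∀ v : V, v ∈ W ↔ ∀ j k, v ≠ x j k) ∧
  IsIndepSet G W ∧
  (∀ j, G.Adj (x j 0) (x j 1)) ∧
  (∀ j k j' k', G.Adj (x j k) (x j' k') → j = j')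

/-- The (open) neighbourhood `N_G(U)` of a set of vertices. -/
def nbd (G : SimpleGraph V) (U : Set V) : Set V := {v | ∃ u ∈ U, G.Adj u v}

/-- The closed neighbourhood `N_G[U]` of a set of vertices. -/
def cnbd (G : SimpleGraph V) (U : Set V) : Set V := U ∪ nbd G U

/-- `G` has a pendant triangle attached to `v`: a triangle through `v` whose other two
vertices have degree exactly `2` in `G`, while `deg v > 2`. -/
def HasPendantTriangle (G : SimpleGraph V) (v : V) : Prop :=
  ∃ t₁ t₂ : V, t₁ ≠ t₂ ∧ G.Adj v t₁ ∧ G.Adj v t₂ ∧ G.Adj t₁ t₂ ∧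
    deg G t₁ = 2 ∧ deg G t₂ = 2 ∧ 2 < deg G v

/-- `A` is a maximal independent set of the induced subgraph of `G` on `S`. -/
def IsMaxIndepOn (G : SimpleGraph V) (S A : Set V) : Prop :=
  A ⊆ S ∧ IsIndepSet G A ∧ ∀ B, A ⊆ B → B ⊆ S → IsIndepSet G B → B = A

/-- Vertex decomposability of the induced subgraph of `G` on the vertex set `S`:
either it is edgeless, or some vertex `v ∈ S` is a shedding vertex (no independent set
of `G_S \ N[v]` is a maximal independent set of `G_S \ v`) such that both
`G_S \ v` and `G_S \ N[v]` are vertex decomposable. -/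
inductive VDOn (G : SimpleGraph V) : Set V → Prop
  | edgeless (S : Set V) : (∀ u ∈ S, ∀ w ∈ S, ¬G.Adj u w) → VDOn G S
  | shed (S : Set V) (v : V) : v ∈ S →
      (∀ A : Set V, A ⊆ S \ {u | u = v ∨ G.Adj v u} → IsIndepSet G A →
        ¬IsMaxIndepOn G (S \ {v}) A) →
      VDOn G (S \ {v}) → VDOn G (S \ {u | u = v ∨ G.Adj v u}) → VDOn G S

/-- `G` is vertex decomposable. -/
def VertexDecomposable (G : SimpleGraph V) : Prop := VDOn G Set.univ

/-- `G` is chordal: every cycle of length greater than `3` has a chord, i.e. an edge of `G`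
joining two vertices of the cycle which is not an edge of the cycle. -/
def IsChordal (G : SimpleGraph V) : Prop :=
  ∀ (v : V) (c : G.Walk v v), c.IsCycle → 3 < c.length →
    ∃ u w : V, u ∈ c.support ∧ w ∈ c.support ∧ G.Adj u w ∧ s(u, w) ∉ c.edges

/-- `C` is a vertex cover of the induced subgraph of `G` on `S`. -/
def IsVertexCoverOn (G : SimpleGraph V) (S C : Set V) : Prop :=
  C ⊆ S ∧ ∀ ⦃u w : V⦄, G.Adj u w → u ∈ S → w ∈ S → u ∈ C ∨ w ∈ C

/-- `C` is a minimal vertex cover of the induced subgraph of `G` on `S`. -/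
def IsMinimalVertexCoverOn (G : SimpleGraph V) (S C : Set V) : Prop :=
  IsVertexCoverOn G S C ∧ ∀ C' ⊆ C, IsVertexCoverOn G S C' → C' = C

/-- `W₀`: the non-isolated vertices of `G` lying in `W`. -/
def W0 (G : SimpleGraph V) (W : Set V) : Set V := W ∩ {v | ∃ u, G.Adj v u}

/-- The set of indices `j` such that both endpoints of the matching edge
`{x j 0, x j 1}` have degree at least `2` in `G` (its cardinality is `m₂`). -/
def m2Set (G : SimpleGraph V) {m : ℕ} (x : Fin m → Fin 2 → V) : Set (Fin m) :=
  {j | 2 ≤ deg G (x j 0) ∧ 2 ≤ deg G (x j 1)}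

/-- The set of indices `j` such that the matching edge `{x j 0, x j 1}` survives in
`G' = G \ N_G[M₂]` with both endpoints of degree at least `2` in `G'`
(its cardinality is `m₂'`; it is empty when `G'` is edgeless). -/
def m2Set' (G : SimpleGraph V) {m : ℕ} (x : Fin m → Fin 2 → V) (M₂ : Set V) :
    Set (Fin m) :=
  {j | x j 0 ∉ cnbd G M₂ ∧ x j 1 ∉ cnbd G M₂ ∧
    2 ≤ (G.neighborSet (x j 0) \ cnbd G M₂).ncard ∧
    2 ≤ (G.neighborSet (x j 1) \ cnbd G M₂).ncard}

/-- `IN_G(U, W)`: the vertices of `W₀` that are isolated in `G \ N_G[U]`. -/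
def INSet (G : SimpleGraph V) (W U : Set V) : Set V :=
  {w | w ∈ W0 G W ∧ w ∉ cnbd G U ∧ ∀ u : V, G.Adj w u → u ∈ cnbd G U}

lemma IsMaximalMatching.exists_mem_mem {G : SimpleGraph V} {M : Set (Sym2 V)}
    (hM : IsMaximalMatching G M) {e : Sym2 V} (he : e ∈ G.edgeSet) :
    ∃ f ∈ M, ∃ x, x ∈ e ∧ x ∈ f := by
  by_contra! h
  have hins : IsMatching G (insert e M) := by
    refine ⟨Set.insert_subset he hM.1.1, ?_⟩
    rintro f (rfl | hf) f' (rfl | hf') hne x hx hx'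
    · exact hne rfl
    · exact h f' hf' x hx hx'
    · exact h f hf x hx' hx
    · exact hM.1.2 f hf f' hf' hne x hx hx'
  have heM : e ∈ M := hM.2 _ hins (Set.subset_insert e M) ▸ Set.mem_insert e M
  induction e with
  | _ a b => exact h _ heM a (by simp) (by simp)

lemma IsMatching.isMaximalMatching {G : SimpleGraph V} {M : Set (Sym2 V)}
    (hM : IsMatching G M) (h : ∀ e ∈ G.edgeSet, ∃ f ∈ M, ∃ x, x ∈ e ∧ x ∈ f) :
    IsMaximalMatching G M := by
  refine ⟨hM, fun M' hM' hsub => Set.Subset.antisymm (fun e he => ?_) hsub⟩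
  obtain ⟨f, hf, x, hxe, hxf⟩ := h e (hM'.1 he)
  by_contra heM
  exact hM'.2 e he f (hsub hf) (fun hef => heM (hef ▸ hf)) x hxe hxf

/-- Distinct edges of an induced matching cannot meet a common edge. -/
lemma IsInducedMatching.eq_of_meet {G : SimpleGraph V} {I : Set (Sym2 V)}
    (hI : IsInducedMatching G I) {e e' f : Sym2 V} (he : e ∈ I) (he' : e' ∈ I)
    (hf : f ∈ G.edgeSet) {x y : V} (hxe : x ∈ e) (hxf : x ∈ f) (hye' : y ∈ e') (hyf : y ∈ f) :
    e = e' := by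
  by_contra hne
  exact (hI.2 e he e' he' hne).2 f hf ⟨⟨x, hxf, hxe⟩, ⟨y, hyf, hye'⟩⟩

lemma IsInducedMatching.ncard_le [Finite V] {G : SimpleGraph V}
    {I M : Set (Sym2 V)} (hI : IsInducedMatching G I) (hM : IsMaximalMatching G M) :
    I.ncard ≤ M.ncard := by
  choose! φ hφM x hxe hxf using fun e (he : e ∈ I) => hM.exists_mem_mem (hI.1 he)
  refine Set.ncard_le_ncard_of_injOn φ hφM (fun e he e' he' h => ?_) (Set.toFinite _)
  exact hI.eq_of_meet he he' (hM.1.1 (hφM e he)) (hxe e he) (hxf e he) (hxe e' he')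
    (h ▸ hxf e' he')

lemma exists_isMaximalMatching_ncard_eq [Finite V] (G : SimpleGraph V) :
    ∃ M, IsMaximalMatching G M ∧ M.ncard = minMatchNum G := by
  have hempty : IsMatching G ∅ := ⟨Set.empty_subset _, by simp⟩
  obtain ⟨M, -, hM⟩ := (Set.toFinite {M | IsMatching G M}).exists_le_maximal hempty
  exact Nat.sInf_mem (s := {n | ∃ M : Set (Sym2 V), IsMaximalMatching G M ∧ M.ncard = n})
    ⟨_, M, ⟨hM.prop, fun M' hM' h => (hM.eq_of_le hM' h).symm⟩, rfl⟩

lemma bddAbove_ncard_isInducedMatching [Finite V] (G : SimpleGraph V) :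
    BddAbove {n | ∃ M : Set (Sym2 V), IsInducedMatching G M ∧ M.ncard = n} := by
  obtain ⟨M, hM, -⟩ := exists_isMaximalMatching_ncard_eq G
  exact ⟨M.ncard, by rintro _ ⟨I, hI, rfl⟩; exact hI.ncard_le hM⟩

lemma exists_isInducedMatching_ncard_eq [Finite V] (G : SimpleGraph V) :
    ∃ I, IsInducedMatching G I ∧ I.ncard = indMatchNum G :=
  Nat.sSup_mem (s := {n | ∃ M : Set (Sym2 V), IsInducedMatching G M ∧ M.ncard = n})
    ⟨_, ∅, ⟨Set.empty_subset _, by simp⟩, rfl⟩ (bddAbove_ncard_isInducedMatching G)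

lemma indMatchNum_le_minMatchNum [Finite V] (G : SimpleGraph V) :
    indMatchNum G ≤ minMatchNum G := by
  obtain ⟨M, hM, hMc⟩ := exists_isMaximalMatching_ncard_eq G
  obtain ⟨I, hI, hIc⟩ := exists_isInducedMatching_ncard_eq G
  exact hMc ▸ hIc ▸ hI.ncard_le hM

/-- A finite set can be enumerated so that the elements satisfying `p` come first. -/
lemma exists_enumeration_of_finite {X : Type*} {I : Set X} (hI : I.Finite) (p : X → Prop) :
    ∃ (α β : ℕ) (g : Fin (α + β) → X), Function.Injective g ∧ Set.range g = I ∧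
      ∀ i, p (g i) ↔ i.1 < α := by
  obtain ⟨α, f, hf, hfr⟩ := (hI.subset (Set.sep_subset I p)).fin_param
  obtain ⟨β, f', hf', hfr'⟩ := (hI.subset (Set.sep_subset I (fun x => ¬ p x))).fin_param
  have hfm (i : Fin α) : f i ∈ I ∧ p (f i) := hfr.subset (Set.mem_range_self i)
  have hfm' (i : Fin β) : f' i ∈ I ∧ ¬ p (f' i) := hfr'.subset (Set.mem_range_self i)
  refine ⟨α, β, Fin.append f f', ?_, ?_, ?_⟩
  · refine Fin.append_injective_iff.2 ⟨hf, hf', fun i j h => (hfm' j).2 (h ▸ (hfm i).2)⟩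
  · ext x
    constructor
    · rintro ⟨i, rfl⟩
      induction i using Fin.addCases with
      | left i => simpa using (hfm i).1
      | right i => simpa using (hfm' i).1
    · intro hx
      by_cases hp : p x
      · obtain ⟨i, rfl⟩ := hfr.superset ⟨hx, hp⟩
        exact ⟨i.castAdd β, by simp⟩
      · obtain ⟨i, rfl⟩ := hfr'.superset ⟨hx, hp⟩
        exact ⟨i.natAdd α, by simp⟩
  · intro i
    induction i using Fin.addCases with
    | left i => simpa using (hfm i).2
    | right i => simpa using (hfm' i).2

/-- If an induced matching and a maximal matching have the same cardinality, every edge of the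
maximal matching meets some edge of the induced matching. -/
lemma IsInducedMatching.exists_mem_mem [Finite V] {G : SimpleGraph V}
    {I M : Set (Sym2 V)} (hI : IsInducedMatching G I) (hM : IsMaximalMatching G M)
    (hcard : I.ncard = M.ncard) {f : Sym2 V} (hf : f ∈ M) :
    ∃ e ∈ I, ∃ x, x ∈ e ∧ x ∈ f := by
  choose! φ hφM x hxe hxf using fun e (he : e ∈ I) => hM.exists_mem_mem (hI.1 he)
  have hinj : Set.InjOn φ I := fun e he e' he' h =>
    hI.eq_of_meet he he' (hM.1.1 (hφM e he)) (hxe e he) (hxf e he) (hxe e' he')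
      (h ▸ hxf e' he')
  have himage : φ '' I = M :=
    Set.eq_of_subset_of_ncard_le (Set.image_subset_iff.2 hφM)
      (by rw [hinj.ncard_image, hcard]) (Set.toFinite _)
  obtain ⟨e, he, rfl⟩ := himage.superset hf
  exact ⟨e, he, x e he, hxe e he, hxf e he⟩

/-- Every edge of an induced matching with as many edges as a maximal matching `M` meets exactly
one edge of `M`. -/
lemma IsInducedMatching.eq_of_meet_of_ncard_eq [Finite V] {G : SimpleGraph V}
    {I M : Set (Sym2 V)} (hI : IsInducedMatching G I) (hM : IsMaximalMatching G M)
    (hcard : I.ncard = M.ncard) {e f f' : Sym2 V} (he : e ∈ I) (hf : f ∈ M) (hf' : f' ∈ M)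
    {x y : V} (hxe : x ∈ e) (hxf : x ∈ f) (hye : y ∈ e) (hyf' : y ∈ f') : f = f' := by
  choose! ψ hψI u hue huf using
    fun f hf => hI.exists_mem_mem hM hcard (f := f) hf
  have hmaps : ψ '' M = I := by
    refine Set.Subset.antisymm (Set.image_subset_iff.2 hψI) fun e he => ?_
    obtain ⟨f, hf, x, hxe, hxf⟩ := hM.exists_mem_mem (hI.1 he)
    exact ⟨f, hf, hI.eq_of_meet (hψI f hf) he (hM.1.1 hf) (hue f hf) (huf f hf) hxe hxf⟩
  have hinj : Set.InjOn ψ M :=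
    Set.injOn_of_ncard_image_eq (by rw [hmaps, hcard]) (Set.toFinite _)
  have h (f : Sym2 V) (hf : f ∈ M) (x : V) (hxe : x ∈ e) (hxf : x ∈ f) : ψ f = e :=
    hI.eq_of_meet (hψI f hf) he (hM.1.1 hf) (hue f hf) (huf f hf) hxe hxf
  exact hinj hf hf' ((h f hf x hxe hxf).trans (h f' hf' y hye hyf').symm)

/-- Every edge `e` of an induced matching shares a vertex `a e` with some edge of a maximal matching;
`b e` and `c e` are the other endpoints of these two edges. -/
lemma IsInducedMatching.exists_endpoints [Finite V] {G : SimpleGraph V}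
    {I M : Set (Sym2 V)} (hI : IsInducedMatching G I) (hM : IsMaximalMatching G M) :
    ∃ a b c : Sym2 V → V, ∀ e ∈ I, e = s(a e, b e) ∧ s(a e, c e) ∈ M := by
  have h (e : Sym2 V) (he : e ∈ I) : ∃ a b c : V, e = s(a, b) ∧ s(a, c) ∈ M := by
    obtain ⟨f, hf, x, ⟨b, hb⟩, ⟨c, hc⟩⟩ := hM.exists_mem_mem (hI.1 he)
    exact ⟨x, b, c, hb, hc ▸ hf⟩
  by_cases hV : Nonempty V
  · choose! a b c h using h
    exact ⟨a, b, c, h⟩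
  · have hE : IsEmpty (Sym2 V) := ⟨fun e => hV ⟨e.out.1⟩⟩
    exact ⟨isEmptyElim, isEmptyElim, isEmptyElim, isEmptyElim⟩

/-- Two matchings, one induced and one maximal, of the same cardinality yield the partition of the
vertex set and the description of the edges. -/
lemma IsInducedMatching.exists_decomposition [Finite V] {G : SimpleGraph V}
    {I M : Set (Sym2 V)} (hI : IsInducedMatching G I) (hM : IsMaximalMatching G M)
    (hcard : I.ncard = M.ncard) :
    ∃ (α β γ : ℕ) (v : Fin (α + β) → Fin 2 → V) (z : Fin α → V) (w : Fin γ → V),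
      Function.Bijective
        (Sum.elim (fun p : Fin (α + β) × Fin 2 => v p.1 p.2) (Sum.elim z w)) ∧
      (∀ i, s(v i 0, v i 1) ∈ G.edgeSet) ∧
      (∀ i : Fin α, s(v (i.castAdd β) 0, z i) ∈ G.edgeSet) ∧
      ∀ e ∈ G.edgeSet,
        (∃ i, e = s(v i 0, v i 1)) ∨ (∃ i, z i ∈ e) ∨
        (∃ i : Fin (α + β), α ≤ i.1 ∧ ∃ (k : Fin 2) (j : Fin γ), e = s(v i k, w j)) ∨
        (∃ (i : Fin α) (j : Fin γ), e = s(v (i.castAdd β) 0, w j)) := by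
  obtain ⟨a, b, c, habc⟩ := hI.exists_endpoints hM
  obtain ⟨α, β, g, hg, rfl, hgM⟩ := exists_enumeration_of_finite (Set.toFinite I) (· ∉ M)
  have hab (i) : g i = s(a (g i), b (g i)) := (habc _ (Set.mem_range_self i)).1
  have hac (i) : s(a (g i), c (g i)) ∈ M := (habc _ (Set.mem_range_self i)).2
  have hedge (i) : G.Adj (a (g i)) (b (g i)) := by
    rw [← SimpleGraph.mem_edgeSet, ← hab]
    exact hI.1 (Set.mem_range_self i)
  have hedge' (i) : G.Adj (a (g i)) (c (g i)) := hM.1.1 (hac i)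
  set v : Fin (α + β) → Fin 2 → V := fun i => ![a (g i), b (g i)] with hvdef
  have hvg (i k) : v i k ∈ g i := by
    rw [hab i]
    fin_cases k <;> simp [hvdef]
  have hmeet {i j : Fin (α + β)} {f : Sym2 V} (hf : f ∈ G.edgeSet) {x y : V} (hx : x ∈ g i)
      (hxf : x ∈ f) (hy : y ∈ g j) (hyf : y ∈ f) : i = j :=
    hg (hI.eq_of_meet (Set.mem_range_self i) (Set.mem_range_self j) hf hx hxf hy hyf)
  have hv {i j k l} (h : v i k = v j l) : i = j ∧ k = l := by
    obtain rfl : i = j :=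
      hmeet (hI.1 (Set.mem_range_self i)) (hvg i k) (hvg i k) (hvg j l) (h ▸ hvg i k)
    refine ⟨rfl, ?_⟩
    have hne := (hedge i).ne
    fin_cases k <;> fin_cases l <;> first | rfl | exact absurd h hne | exact absurd h.symm hne
  set z : Fin α → V := fun i => c (g (i.castAdd β)) with hzdef
  have hzv (i : Fin α) (j : Fin (α + β)) (k : Fin 2) : v j k ≠ z i := by
    intro h
    obtain rfl : i.castAdd β = j := hmeet (hM.1.1 (hac (i.castAdd β))) (hvg _ 0)
      (by simp [hvdef]) (hvg j k) (by simp [h, hzdef])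
    have hne := (hedge' (i.castAdd β)).ne
    have hnM : g (i.castAdd β) ∉ M := (hgM _).2 (by simp)
    rw [hab] at hnM
    fin_cases k
    · exact hne h
    · exact hnM ((show b _ = c _ from h) ▸ hac (i.castAdd β))
  have hz : Function.Injective z := by
    intro i j h
    have hf : s(a (g (i.castAdd β)), c (g (i.castAdd β))) =
        s(a (g (j.castAdd β)), c (g (j.castAdd β))) := by
      by_contra hne
      exact hM.1.2 _ (hac _) _ (hac _) hne (z i) (by simp [hzdef]) (by rw [h]; simp [hzdef])
    refine Fin.castAdd_injective α β (hmeet (hM.1.1 (hac (i.castAdd β))) (hvg _ 0)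
      (by simp [hvdef]) (hvg _ 0) ?_)
    rw [hf]
    simp [hvdef]
  obtain ⟨γ, w, hw, hwr⟩ := (Set.toFinite
    (Set.range (Sum.elim (fun p : Fin (α + β) × Fin 2 => v p.1 p.2) z))ᶜ).fin_param
  have hwmem (j : Fin γ) : (∀ i k, v i k ≠ w j) ∧ ∀ i, z i ≠ w j := by
    have := hwr.subset (Set.mem_range_self j)
    simpa using this
  have hcover (x : V) : (∃ i k, x = v i k) ∨ (∃ i, x = z i) ∨ ∃ j, x = w j := by
    by_cases hx : x ∈ Set.range (Sum.elim (fun p : Fin (α + β) × Fin 2 => v p.1 p.2) z)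
    · obtain ⟨⟨i, k⟩ | i, rfl⟩ := hx
      · exact .inl ⟨i, k, rfl⟩
      · exact .inr (.inl ⟨i, rfl⟩)
    · obtain ⟨j, rfl⟩ := hwr.superset hx
      exact .inr (.inr ⟨j, rfl⟩)
  have hMv {f : Sym2 V} (hf : f ∈ M) {x : V} (hx : x ∈ f) :
      (∃ i, x = z i) ∨ (∃ i : Fin α, x = v (i.castAdd β) 0) ∨
        ∃ i : Fin (α + β), α ≤ i.1 ∧ ∃ k, x = v i k := by
    obtain ⟨_, ⟨i, rfl⟩, u, hu, huf⟩ := hI.exists_mem_mem hM hcard hf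
    have hfi {f' : Sym2 V} (hf' : f' ∈ M) {y : V} (hy : y ∈ g i) (hyf : y ∈ f') : f = f' :=
      hI.eq_of_meet_of_ncard_eq hM hcard (Set.mem_range_self i) hf hf' hu huf hy hyf
    by_cases hi : i.1 < α
    · obtain ⟨i, rfl⟩ : ∃ i' : Fin α, i = i'.castAdd β := ⟨⟨i, hi⟩, rfl⟩
      rw [hfi (hac (i.castAdd β)) (hvg _ 0) (by simp [hvdef]), Sym2.mem_iff] at hx
      exact hx.elim (fun h => .inr (.inl ⟨i, h⟩)) (fun h => .inl ⟨i, h⟩)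
    · rw [hfi (not_not.1 ((hgM i).not.2 hi)) (hvg i 0) (hvg i 0), hab, Sym2.mem_iff] at hx
      exact .inr (.inr ⟨i, not_lt.1 hi, hx.elim (fun h => ⟨0, h⟩) (fun h => ⟨1, h⟩)⟩)
  refine ⟨α, β, γ, v, z, w, ⟨?_, fun x => ?_⟩, hedge, fun i => hedge' _, fun e he => ?_⟩
  · refine Function.Injective.sumElim ?_ (hz.sumElim hw fun i j => (hwmem j).2 i) ?_
    · rintro ⟨i, k⟩ ⟨j, l⟩ h
      exact Prod.ext_iff.2 (hv h)
    · rintro ⟨i, k⟩ (j | j)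
      · exact hzv j i k
      · exact (hwmem j).1 i k
  · obtain ⟨i, k, rfl⟩ | ⟨i, rfl⟩ | ⟨j, rfl⟩ := hcover x
    · exact ⟨.inl (i, k), rfl⟩
    · exact ⟨.inr (.inl i), rfl⟩
    · exact ⟨.inr (.inr j), rfl⟩
  · obtain ⟨f, hf, x, ⟨y, rfl⟩, hxf⟩ := hM.exists_mem_mem he
    have hvv {i j k l} (h : s(v i k, v j l) ∈ G.edgeSet) :
        ∃ i', s(v i k, v j l) = s(v i' 0, v i' 1) := by
      obtain rfl : i = j := hmeet h (hvg i k) (by simp) (hvg j l) (by simp)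
      have hne : v i k ≠ v i l := G.ne_of_adj h
      refine ⟨i, ?_⟩
      fin_cases k <;> fin_cases l <;> first | rfl | exact Sym2.eq_swap | exact absurd rfl hne
    obtain ⟨j, l, rfl⟩ | ⟨i, rfl⟩ | ⟨j, rfl⟩ := hcover y
    · obtain ⟨i, rfl⟩ | ⟨i, rfl⟩ | ⟨i, hi, k, rfl⟩ := hMv hf hxf
      · exact .inr (.inl ⟨i, by simp⟩)
      · exact .inl (hvv he)
      · exact .inl (hvv he)
    · exact .inr (.inl ⟨i, by simp⟩)
    · obtain ⟨i, rfl⟩ | ⟨i, rfl⟩ | ⟨i, hi, k, rfl⟩ := hMv hf hxf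
      · exact .inr (.inl ⟨i, by simp⟩)
      · exact .inr (.inr (.inr ⟨i, j, rfl⟩))
      · exact .inr (.inr (.inl ⟨i, hi, k, j, rfl⟩))

/-- In a decomposed graph the edges `{v i 0, v i 1}` form an induced matching, and replacing the
first `α` of them by the `{v i 0, z i}` gives a maximal matching. -/
lemma indMatchNum_eq_minMatchNum_of_decomposition [Finite V] {G : SimpleGraph V}
    {α β γ : ℕ} {v : Fin (α + β) → Fin 2 → V} {z : Fin α → V} {w : Fin γ → V}
    (hinj : Function.Injective
      (Sum.elim (fun p : Fin (α + β) × Fin 2 => v p.1 p.2) (Sum.elim z w)))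
    (hedge : ∀ i, s(v i 0, v i 1) ∈ G.edgeSet)
    (hedge' : ∀ i : Fin α, s(v (i.castAdd β) 0, z i) ∈ G.edgeSet)
    (hG : ∀ e ∈ G.edgeSet,
      (∃ i, e = s(v i 0, v i 1)) ∨ (∃ i, z i ∈ e) ∨
      (∃ i : Fin (α + β), α ≤ i.1 ∧ ∃ (k : Fin 2) (j : Fin γ), e = s(v i k, w j)) ∨
      (∃ (i : Fin α) (j : Fin γ), e = s(v (i.castAdd β) 0, w j))) :
    indMatchNum G = minMatchNum G := by
  have hv {i j k l} (h : v i k = v j l) : i = j := by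
    have := @hinj (.inl (i, k)) (.inl (j, l)) h
    simp_all
  have hvz (i k j) : v i k ≠ z j := fun h => by
    simpa using @hinj (.inl (i, k)) (.inr (.inl j)) h
  have hvw (i k j) : v i k ≠ w j := fun h => by
    simpa using @hinj (.inl (i, k)) (.inr (.inr j)) h
  have hz {i j} (h : z i = z j) : i = j := by
    simpa using @hinj (.inr (.inl i)) (.inr (.inl j)) h
  have hvv {i j k l} (h : s(v i k, v j l) ∈ G.edgeSet) : i = j := by
    obtain ⟨i', h⟩ | ⟨i', h⟩ | ⟨i', -, k', j', h⟩ | ⟨i', j', h⟩ := hG _ h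
    · rcases Sym2.eq_iff.1 h with ⟨h, h'⟩ | ⟨h, h'⟩ <;> exact (hv h).trans (hv h').symm
    · rcases Sym2.mem_iff.1 h with h | h <;> exact absurd h.symm (hvz _ _ _)
    all_goals
      rcases Sym2.eq_iff.1 h with ⟨-, h⟩ | ⟨h, -⟩ <;> exact absurd h (hvw _ _ _)
  refine (indMatchNum_le_minMatchNum G).antisymm (le_trans (b := α + β) ?_ ?_)
  · set g : Fin (α + β) → Sym2 V := fun i =>
      if h : i.1 < α then s(v i 0, z ⟨i, h⟩) else s(v i 0, v i 1) with hg
    have hg_lt (i : Fin α) : g (i.castAdd β) = s(v (i.castAdd β) 0, z i) := by simp [hg]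
    have hg_ge {i : Fin (α + β)} (hi : ¬ i.1 < α) : g i = s(v i 0, v i 1) := by simp [hg, hi]
    have hg_mem {i x} (hx : x ∈ g i) :
        (∃ k, x = v i k) ∨ ∃ i' : Fin α, i'.castAdd β = i ∧ x = z i' := by
      by_cases hi : i.1 < α
      · obtain ⟨i, rfl⟩ : ∃ i' : Fin α, i = i'.castAdd β := ⟨⟨i, hi⟩, rfl⟩
        rw [hg_lt, Sym2.mem_iff] at hx
        exact hx.imp (fun h => ⟨0, h⟩) (fun h => ⟨i, rfl, h⟩)
      · rw [hg_ge hi, Sym2.mem_iff] at hx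
        exact .inl (hx.elim (fun h => ⟨0, h⟩) (fun h => ⟨1, h⟩))
    have hg_zero (i) : v i 0 ∈ g i := by
      by_cases hi : i.1 < α <;> simp [hg, hi]
    have hmatch : IsMatching G (Set.range g) := by
      refine ⟨?_, ?_⟩
      · rintro _ ⟨i, rfl⟩
        by_cases hi : i.1 < α
        · simpa [hg, hi] using hedge' ⟨i, hi⟩
        · simpa [hg, hi] using hedge i
      · rintro _ ⟨i, rfl⟩ _ ⟨j, rfl⟩ hne x hx hx'
        apply hne
        congr 1
        obtain ⟨k, rfl⟩ | ⟨i, rfl, rfl⟩ := hg_mem hx <;>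
          obtain ⟨l, h⟩ | ⟨j, rfl, h⟩ := hg_mem hx'
        · exact hv h
        · exact absurd h (hvz _ _ _)
        · exact absurd h.symm (hvz _ _ _)
        · rw [hz h]
    have hmax : IsMaximalMatching G (Set.range g) := by
      refine hmatch.isMaximalMatching fun e he => ?_
      obtain ⟨i, rfl⟩ | ⟨i, h⟩ | ⟨i, hi, k, j, rfl⟩ | ⟨i, j, rfl⟩ := hG _ he
      · exact ⟨_, ⟨i, rfl⟩, v i 0, by simp, hg_zero i⟩
      · exact ⟨_, ⟨i.castAdd β, rfl⟩, z i, h, by simp [hg_lt]⟩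
      · refine ⟨_, ⟨i, rfl⟩, v i k, by simp, ?_⟩
        rw [hg_ge (not_lt.2 hi)]
        fin_cases k <;> simp
      · exact ⟨_, ⟨i.castAdd β, rfl⟩, v (i.castAdd β) 0, by simp, hg_zero _⟩
    have hle : minMatchNum G ≤ (Set.range g).ncard := Nat.sInf_le ⟨_, hmax, rfl⟩
    refine hle.trans ?_
    rw [← Set.image_univ]
    exact (Set.ncard_image_le).trans (by simp)
  · set g : Fin (α + β) → Sym2 V := fun i => s(v i 0, v i 1) with hg
    have hg_mem {i x} (hx : x ∈ g i) : ∃ k, x = v i k :=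
      (Sym2.mem_iff.1 hx).elim (fun h => ⟨0, h⟩) (fun h => ⟨1, h⟩)
    have hg_inj : Function.Injective g := fun i j h => by
      obtain ⟨k, hk⟩ := hg_mem (i := j) (x := v i 0) (h ▸ by simp [hg])
      exact hv hk
    have hind : IsInducedMatching G (Set.range g) := by
      refine ⟨by rintro _ ⟨i, rfl⟩; exact hedge i, ?_⟩
      rintro _ ⟨i, rfl⟩ _ ⟨j, rfl⟩ hne
      refine ⟨fun x hx hx' => ?_, ?_⟩
      · obtain ⟨k, rfl⟩ := hg_mem hx
        obtain ⟨l, h⟩ := hg_mem hx'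
        exact hne (congrArg g (hv h))
      · rintro f hf ⟨⟨x, hxf, hx⟩, ⟨y, hyf, hy⟩⟩
        obtain ⟨k, rfl⟩ := hg_mem hx
        obtain ⟨l, rfl⟩ := hg_mem hy
        have hxy : v i k ≠ v j l := fun h => hne (congrArg g (hv h))
        rw [(Sym2.mem_and_mem_iff hxy).1 ⟨hxf, hyf⟩] at hf
        exact hne (congrArg g (hvv hf))
    refine le_csSup (bddAbove_ncard_isInducedMatching G) ⟨_, hind, ?_⟩
    rw [← Set.image_univ, Set.ncard_image_of_injective _ hg_inj]
    simp



/-- characterization of the finite simple graphs `G` with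
`ind-match(G) = min-match(G)`.  The vertex set is partitioned into the pairs
`v i 0, v i 1` (`i : Fin (α+β)`), the vertices `z i` (`i : Fin α`) and the vertices
`w j` (`j : Fin γ`) — this is expressed by the bijectivity below — and the edge set of
`G` consists of the edges `e_i = {v i 0, v i 1}`, the edges `e_i' = {v i 0, z i}` for
`i < α`, and further edges `E'`, each of which (i) contains some `z i`, or (ii) joins an
endpoint of `e_i` with `α ≤ i` to some `w j`, or (iii) joins some `v i 0` with `i < α` to
some `w j`. -/
theorem indMatchNum_eq_minMatchNum_iff {V : Type*} [Fintype V] [DecidableEq V]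
    (G : SimpleGraph V) :
    indMatchNum G = minMatchNum G ↔
      ∃ (α β γ : ℕ) (v : Fin (α + β) → Fin 2 → V) (z : Fin α → V) (w : Fin γ → V),
        Function.Bijective
          (Sum.elim (fun p : Fin (α + β) × Fin 2 => v p.1 p.2) (Sum.elim z w) :
            (Fin (α + β) × Fin 2) ⊕ (Fin α ⊕ Fin γ) → V) ∧
        ∃ E' : Set (Sym2 V),
          G.edgeSet =
            {e | ∃ i : Fin (α + β), e = s(v i 0, v i 1)} ∪
            {e | ∃ i : Fin α,
              e = s(v (⟨i.1, by have := i.2; omega⟩ : Fin (α + β)) 0, z i)} ∪ E' ∧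
          ∀ e ∈ E',
            (∃ i : Fin α, z i ∈ e) ∨
            (∃ i : Fin (α + β), α ≤ i.1 ∧ ∃ (k : Fin 2) (j : Fin γ), e = s(v i k, w j)) ∨
            (∃ (i : Fin α) (j : Fin γ),
              e = s(v (⟨i.1, by have := i.2; omega⟩ : Fin (α + β)) 0, w j)) := by
  constructor
  · intro h
    obtain ⟨I, hI, hIc⟩ := exists_isInducedMatching_ncard_eq G
    obtain ⟨M, hM, hMc⟩ := exists_isMaximalMatching_ncard_eq G
    obtain ⟨α, β, γ, v, z, w, hbij, hedge, hedge', hG⟩ :=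
      hI.exists_decomposition hM (by rw [hIc, hMc, h])
    refine ⟨α, β, γ, v, z, w, hbij, {e ∈ G.edgeSet | (∃ i, z i ∈ e) ∨
        (∃ i : Fin (α + β), α ≤ i.1 ∧ ∃ (k : Fin 2) (j : Fin γ), e = s(v i k, w j)) ∨
        (∃ (i : Fin α) (j : Fin γ), e = s(v (i.castAdd β) 0, w j))}, ?_, fun e he => he.2⟩
    refine Set.Subset.antisymm (fun e he => ?_) ?_
    · exact (hG e he).elim (fun h => .inl (.inl h)) (fun h => .inr ⟨he, h⟩)
    · rintro e ((⟨i, rfl⟩ | ⟨i, rfl⟩) | he)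
      · exact hedge i
      · exact hedge' i
      · exact he.1
  · rintro ⟨α, β, γ, v, z, w, hbij, E', hE, hE'⟩
    refine indMatchNum_eq_minMatchNum_of_decomposition hbij.injective
      (fun i => hE.superset (.inl (.inl ⟨i, rfl⟩)))
      (fun i => hE.superset (.inl (.inr ⟨i, rfl⟩))) fun e he => ?_
    obtain (h | ⟨i, rfl⟩) | h := hE.subset he
    · exact .inl h
    · exact .inr (.inl ⟨i, by simp⟩)
    · exact .inr (hE' e h)

end DIM
end

section
/- Let G be a finite simple graph on a vertex set V with a dominating induced matching. For a decomposition V = W ⊔ M, where W is an independent set and the induced subgraph G_M consists of m disjoint edges {x_{j1}, x_{j2}} (j = 1, …, m), set: W_0 = { w ∈ W : w is not isolated in G }; m_2 = #{ j : deg_G(x_{j1}) ≥ 2 and deg_G(x_{j2}) ≥ 2 }; for U ⊆ V, IN_G(U, W) = the set of vertices of W_0 that are isolated in G \ N_G[U]. Call a subset M_2 ⊆ M admissible if (∗1) #(M_2 ∩ {x_{j1}, x_{j2}}) ≤ 1 for all j and (∗2) deg_G(x) ≥ 2 for all x ∈ M_2. For admissible M_2, let G' = G \ N_G[M_2] with induced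 decomposition V(G') = (W \ N_G[M_2]) ⊔ (M \ N_G[M_2]), and let m_2' be the number of edges {x_{j1}, x_{j2}} of G' lying in M \ N_G[M_2] with both endpoints of degree ≥ 2 in G' (set m_2' = 0 if G' is edgeless). Then: G is unmixed if and only if for some (equivalently, every) such decomposition V = W ⊔ M, every admissible subset M_2 ⊆ M satisfies both (♭1) m_2 − m_2' = #N_G(M_2) − #M_2, and (♭2) #W_0 ≤ 2·m_2 − #N_G(M_2) + #M_2 + #IN_G(M_2, W). -/
namespace DIM

open SimpleGraph

variable {V : Type*}

section IndependentSets

variable {G : SimpleGraph V}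

/-- `A` is independent and every vertex outside `A` has a neighbour in `A`; equivalently, `A` is
a maximal independent set. -/
def IsIndepDominating (G : SimpleGraph V) (A : Set V) : Prop :=
  IsIndepSet G A ∧ ∀ v ∉ A, ∃ u ∈ A, G.Adj v u

lemma isMinimalVertexCover_iff (C : Set V) :
    IsMinimalVertexCover G C ↔ IsIndepDominating G Cᶜ := by
  constructor
  · rintro ⟨hC, hmin⟩
    refine ⟨fun a ha b hb hab => (hC hab).elim ha hb, fun v hv => ?_⟩
    rw [Set.mem_compl_iff, not_not] at hv
    by_contra! hno
    have hcov : IsVertexCover G (C \ {v}) := by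
      intro a b hab
      by_cases ha : a = v
      · subst ha
        exact Or.inr ⟨not_not.1 fun h => hno b h hab, fun h => hab.ne h.symm⟩
      by_cases hb : b = v
      · subst hb
        exact Or.inl ⟨not_not.1 fun h => hno a h hab.symm, ha⟩
      exact (hC hab).imp (fun h => ⟨h, ha⟩) (fun h => ⟨h, hb⟩)
    have := hmin _ Set.sdiff_subset hcov
    rw [← this] at hv
    exact hv.2 rfl
  · rintro ⟨hI, hdom⟩
    refine ⟨fun a b hab => ?_, fun C' hsub hC' => hsub.antisymm fun v hv => ?_⟩
    · by_contra! h
      exact hI a h.1 b h.2 hab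
    · obtain ⟨u, hu, hvu⟩ := hdom v (not_not.2 hv)
      exact (hC' hvu).resolve_right fun h => hu (hsub h)

lemma unmixed_iff_isIndepDominating [Finite V] :
    Unmixed G ↔ ∀ A B : Set V, IsIndepDominating G A → IsIndepDominating G B →
      A.ncard = B.ncard := by
  constructor
  · intro h A B hA hB
    have := h Aᶜ Bᶜ ((isMinimalVertexCover_iff _).2 (by rwa [compl_compl]))
      ((isMinimalVertexCover_iff _).2 (by rwa [compl_compl]))
    have h1 := Set.ncard_add_ncard_compl A
    have h2 := Set.ncard_add_ncard_compl B
    omega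
  · intro h C C' hC hC'
    have := h _ _ ((isMinimalVertexCover_iff _).1 hC) ((isMinimalVertexCover_iff _).1 hC')
    have h1 := Set.ncard_add_ncard_compl C
    have h2 := Set.ncard_add_ncard_compl C'
    omega

lemma IsIndepSet.exists_isIndepDominating [Finite V] {S : Set V} (hS : IsIndepSet G S) :
    ∃ A, S ⊆ A ∧ IsIndepDominating G A := by
  obtain ⟨A, hSA, hA⟩ := Finite.exists_le_maximal (p := IsIndepSet G) hS
  refine ⟨A, hSA, hA.1, fun v hv => ?_⟩
  by_contra! hno
  refine hv (hA.2 (y := insert v A) ?_ (Set.subset_insert _ _) (Set.mem_insert _ _))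
  rintro a (rfl | ha) b (rfl | hb)
  · exact G.irrefl
  · exact hno b hb
  · exact fun h => hno a ha h.symm
  · exact hA.1 a ha b hb

end IndependentSets

namespace IsDimDecomp

variable {G : SimpleGraph V} {W : Set V} {m : ℕ} {x : Fin m → Fin 2 → V}

lemma notMem (hdec : IsDimDecomp G W x) (j k) : x j k ∉ W :=
  fun h => (hdec.2.1 _).1 h j k rfl

lemma exists_eq (hdec : IsDimDecomp G W x) {v : V} (hv : v ∉ W) : ∃ j k, v = x j k := by
  by_contra! h
  exact hv ((hdec.2.1 v).2 h)

lemma eq_iff (hdec : IsDimDecomp G W x) {j k j' k'} : x j k = x j' k' ↔ j = j' ∧ k = k' :=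
  ⟨fun h => by simpa using hdec.1 (a₁ := (j, k)) (a₂ := (j', k')) h, by rintro ⟨rfl, rfl⟩; rfl⟩

lemma adj_partner (hdec : IsDimDecomp G W x) (j k) : G.Adj (x j k) (x j (k + 1)) := by
  have := hdec.2.2.2.1 j
  fin_cases k
  · exact this
  · exact this.symm

lemma adj_iff (hdec : IsDimDecomp G W x) {j k j' k'} :
    G.Adj (x j k) (x j' k') ↔ j' = j ∧ k' = k + 1 := by
  constructor
  · intro h
    obtain rfl := hdec.2.2.2.2 _ _ _ _ h
    refine ⟨rfl, ?_⟩
    have : k ≠ k' := by rintro rfl; exact G.irrefl h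
    omega
  · rintro ⟨rfl, rfl⟩
    exact hdec.adj_partner _ _

lemma eq_partner_or_mem (hdec : IsDimDecomp G W x) {j k v} (h : G.Adj (x j k) v) :
    v = x j (k + 1) ∨ v ∈ W := by
  by_cases hv : v ∈ W
  · exact Or.inr hv
  · obtain ⟨j', k', rfl⟩ := hdec.exists_eq hv
    obtain ⟨rfl, rfl⟩ := hdec.adj_iff.1 h
    exact Or.inl rfl

lemma mem_nbd_iff (hdec : IsDimDecomp G W x) {T : Set V} (hT : Disjoint T W) {j k} :
    x j k ∈ nbd G T ↔ x j (k + 1) ∈ T := by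
  constructor
  · rintro ⟨u, hu, hadj⟩
    rcases hdec.eq_partner_or_mem hadj.symm with rfl | h
    · exact hu
    · exact absurd h (Set.disjoint_left.1 hT hu)
  · exact fun h => ⟨_, h, (hdec.adj_partner j k).symm⟩

lemma ncard_sdiff (hdec : IsDimDecomp G W x) {S : Set V}
    (hS : ∀ j, ¬(x j 0 ∈ S ∧ x j 1 ∈ S)) :
    (S \ W).ncard = {j | ∃ k, x j k ∈ S}.ncard := by
  classical
  let f : Fin m → V := fun j => if x j 0 ∈ S then x j 0 else x j 1
  have hf : Function.Injective f := by
    intro j j' h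
    simp only [f] at h
    split_ifs at h <;> exact (hdec.eq_iff.1 h).1
  rw [← Set.ncard_image_of_injective _ hf]
  congr 1
  ext v
  constructor
  · rintro ⟨hv, hvW⟩
    obtain ⟨j, k, rfl⟩ := hdec.exists_eq hvW
    refine ⟨j, ⟨k, hv⟩, ?_⟩
    have := hS j
    fin_cases k <;> simp only [f] <;> split_ifs <;> simp_all
  · rintro ⟨j, ⟨k, hk⟩, rfl⟩
    simp only [f]
    split_ifs with h
    · exact ⟨h, hdec.notMem _ _⟩
    · refine ⟨?_, hdec.notMem _ _⟩
      fin_cases k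
      · exact absurd hk h
      · exact hk

lemma m2Set'_empty : m2Set' G x ∅ = m2Set G x := by
  simp [m2Set', m2Set, cnbd, nbd, deg]

variable [Finite V]

lemma two_le_ncard_iff (hdec : IsDimDecomp G W x) {j k} {R : Set V} (hR : x j (k + 1) ∉ R) :
    2 ≤ (G.neighborSet (x j k) \ R).ncard ↔ ∃ w ∈ W, w ∉ R ∧ G.Adj (x j k) w := by
  rw [Nat.succ_le_iff, Set.one_lt_ncard_iff (Set.toFinite _)]
  constructor
  · rintro ⟨a, b, ⟨ha, haR⟩, ⟨hb, hbR⟩, hab⟩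
    rcases hdec.eq_partner_or_mem ha with rfl | h
    · rcases hdec.eq_partner_or_mem hb with rfl | h
      · exact absurd rfl hab
      · exact ⟨b, h, hbR, hb⟩
    · exact ⟨a, h, haR, ha⟩
  · rintro ⟨w, hw, hwR, hadj⟩
    refine ⟨w, x j (k + 1), ⟨hadj, hwR⟩, ⟨hdec.adj_partner j k, hR⟩, ?_⟩
    rintro rfl
    exact hdec.notMem _ _ hw

lemma two_le_deg_iff (hdec : IsDimDecomp G W x) {j k} :
    2 ≤ deg G (x j k) ↔ ∃ w ∈ W, G.Adj (x j k) w := by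
  simpa [deg] using hdec.two_le_ncard_iff (j := j) (k := k) (Set.notMem_empty _)

lemma ncard_nbd (hdec : IsDimDecomp G W x) {T : Set V} (hT : Disjoint T W)
    (h1 : ∀ j, ¬(x j 0 ∈ T ∧ x j 1 ∈ T)) :
    (nbd G T).ncard = (nbd G T ∩ W).ncard + T.ncard := by
  have hN : (nbd G T \ W).ncard = (T \ W).ncard := by
    rw [hdec.ncard_sdiff h1, hdec.ncard_sdiff]
    · congr 1
      ext j
      simp [Fin.exists_fin_two, hdec.mem_nbd_iff hT, or_comm]
    · intro j
      simpa [hdec.mem_nbd_iff hT, and_comm] using h1 j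
  rw [hT.sdiff_eq_left] at hN
  rw [← hN, Set.ncard_inter_add_ncard_sdiff_eq_ncard _ _ (Set.toFinite _)]

lemma mem_m2Set'_iff (hdec : IsDimDecomp G W x) {T : Set V} (hT : Disjoint T W) {j} :
    j ∈ m2Set' G x T ↔ ∀ k, x j k ∉ T ∧ ∃ w ∈ W, w ∉ nbd G T ∧ G.Adj (x j k) w := by
  have key (k) (h : x j (k + 1) ∉ cnbd G T) :
      2 ≤ (G.neighborSet (x j k) \ cnbd G T).ncard ↔
        ∃ w ∈ W, w ∉ nbd G T ∧ G.Adj (x j k) w := by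
    rw [hdec.two_le_ncard_iff h]
    refine exists_congr fun w => and_congr_right fun hw => ?_
    simp [cnbd, Set.disjoint_right.1 hT hw]
  have hc (k) : x j k ∉ cnbd G T ↔ x j k ∉ T ∧ x j (k + 1) ∉ T := by
    simp [cnbd, hdec.mem_nbd_iff hT]
  constructor
  · rintro ⟨h0, h1, h2, h3⟩
    rw [key 0 h1] at h2
    rw [key 1 h0] at h3
    rw [hc] at h0
    exact Fin.forall_fin_two.2 ⟨⟨h0.1, h2⟩, ⟨h0.2, h3⟩⟩
  · intro h
    have h0 : x j 0 ∉ cnbd G T := (hc 0).2 ⟨(h 0).1, (h 1).1⟩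
    have h1 : x j 1 ∉ cnbd G T := (hc 1).2 ⟨(h 1).1, (h 0).1⟩
    exact ⟨h0, h1, (key 0 h1).2 (h 0).2, (key 1 h0).2 (h 1).2⟩

lemma ncard_add_of_isIndepDominating (hdec : IsDimDecomp G W x) {A T : Set V}
    (hA : IsIndepDominating G A) (hT : Disjoint T W) (hTA : T ⊆ A) (hWA : W \ nbd G T ⊆ A) :
    A.ncard + (nbd G T ∩ W).ncard + (m2Set' G x T).ncard = W.ncard + m := by
  have hAW : A ∩ W = W \ nbd G T := by
    ext w
    refine ⟨fun ⟨ha, hw⟩ => ⟨hw, fun ⟨u, hu, huw⟩ => hA.1 u (hTA hu) w ha huw⟩,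
      fun h => ⟨hWA h, h.1⟩⟩
  have hhit : {j | ∃ k, x j k ∈ A} = (m2Set' G x T)ᶜ := by
    ext j
    rw [Set.mem_compl_iff, hdec.mem_m2Set'_iff hT]
    constructor
    · rintro ⟨k, hk⟩ h
      obtain ⟨-, w, hw, hwn, hadj⟩ := h k
      exact hA.1 _ hk w (hWA ⟨hw, hwn⟩) hadj
    · intro h
      by_contra hno
      refine h fun k => ?_
      have hno' : ∀ k, x j k ∉ A := fun k hk => hno ⟨k, hk⟩
      refine ⟨fun hk => hno' k (hTA hk), ?_⟩
      obtain ⟨u, hu, hadj⟩ := hA.2 _ (hno' k)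
      rcases hdec.eq_partner_or_mem hadj with rfl | hw
      · exact absurd hu (hno' _)
      · have : u ∈ A ∩ W := ⟨hu, hw⟩
        rw [hAW] at this
        exact ⟨u, hw, this.2, hadj⟩
  have h1 := hdec.ncard_sdiff (S := A) fun j hj => hA.1 _ hj.1 _ hj.2 (hdec.2.2.2.1 j)
  have h2 := Set.ncard_inter_add_ncard_sdiff_eq_ncard A W (Set.toFinite _)
  have h3 := Set.ncard_inter_add_ncard_sdiff_eq_ncard W (nbd G T) (Set.toFinite _)
  have h4 := Set.ncard_add_ncard_compl (m2Set' G x T)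
  rw [Nat.card_fin] at h4
  rw [hhit] at h1
  rw [hAW] at h2
  rw [Set.inter_comm] at h3
  omega

/-- The maximal independent sets of `G` are equicardinal iff the first flat condition holds. -/
lemma unmixed_iff (hdec : IsDimDecomp G W x) :
    Unmixed G ↔ ∀ T : Set V, Disjoint T W → (∀ j, ¬(x j 0 ∈ T ∧ x j 1 ∈ T)) →
      (∀ v ∈ T, 2 ≤ deg G v) →
      (nbd G T ∩ W).ncard + (m2Set' G x T).ncard = (m2Set G x).ncard := by
  rw [unmixed_iff_isIndepDominating]
  constructor
  · intro h T hT hT1 _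
    have hind : IsIndepSet G (T ∪ W \ nbd G T) := by
      rintro a (ha | ha) b (hb | hb) hab
      · obtain ⟨j, k, rfl⟩ := hdec.exists_eq (Set.disjoint_left.1 hT ha)
        obtain ⟨j', k', rfl⟩ := hdec.exists_eq (Set.disjoint_left.1 hT hb)
        obtain ⟨rfl, rfl⟩ := hdec.adj_iff.1 hab
        fin_cases k
        · exact hT1 _ ⟨ha, hb⟩
        · exact hT1 _ ⟨hb, ha⟩
      · exact hb.2 ⟨a, ha, hab⟩
      · exact ha.2 ⟨b, hb, hab.symm⟩
      · exact hdec.2.2.1 a ha.1 b hb.1 hab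
    obtain ⟨A, hTA, hA⟩ := hind.exists_isIndepDominating
    obtain ⟨B, hWB, hB⟩ := IsIndepSet.exists_isIndepDominating hdec.2.2.1
    have e1 := hdec.ncard_add_of_isIndepDominating hA hT (Set.subset_union_left.trans hTA)
      (Set.subset_union_right.trans hTA)
    have e2 := hdec.ncard_add_of_isIndepDominating hB (Set.empty_disjoint W)
      (Set.empty_subset _) (Set.sdiff_subset.trans hWB)
    have e3 : nbd G (∅ : Set V) ∩ W = ∅ := by simp [nbd]
    rw [m2Set'_empty, e3, Set.ncard_empty] at e2
    have := h A B hA hB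
    omega
  · intro h
    suffices key : ∀ A, IsIndepDominating G A →
        A.ncard + (m2Set G x).ncard = W.ncard + m from fun A B hA hB => by
      have := key A hA
      have := key B hB
      omega
    intro A hA
    let T : Set V := {v | v ∈ A ∧ v ∉ W ∧ 2 ≤ deg G v}
    have hT : Disjoint T W := Set.disjoint_left.2 fun _ hv => hv.2.1
    have hWA : W \ nbd G T ⊆ A := by
      rintro w ⟨hw, hwT⟩
      by_contra hwA
      obtain ⟨u, hu, hadj⟩ := hA.2 w hwA
      have huW : u ∉ W := fun h => hdec.2.2.1 w hw u h hadj
      refine hwT ⟨u, ⟨hu, huW, ?_⟩, hadj.symm⟩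
      obtain ⟨j, k, rfl⟩ := hdec.exists_eq huW
      exact hdec.two_le_deg_iff.2 ⟨w, hw, hadj.symm⟩
    have e1 := hdec.ncard_add_of_isIndepDominating hA hT (fun _ hv => hv.1) hWA
    have e2 := h T hT (fun j hj => hA.1 _ hj.1.1 _ hj.2.1 (hdec.2.2.2.1 j)) fun _ hv => hv.2.2
    omega

lemma ncard_W0_add_le (hdec : IsDimDecomp G W x) (hG : Unmixed G) {T : Set V}
    (hT : Disjoint T W) (hT1 : ∀ j, ¬(x j 0 ∈ T ∧ x j 1 ∈ T)) (hT2 : ∀ v ∈ T, 2 ≤ deg G v) :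
    (W0 G W).ncard + (nbd G T ∩ W).ncard ≤ 2 * (m2Set G x).ncard + (INSet G W T).ncard := by
  let E : Fin 2 → Set V := fun k =>
    T ∪ {v | ∃ j, v = x j k ∧ x j 0 ∉ T ∧ x j 1 ∉ T ∧ 2 ≤ deg G v}
  have hE (k) : (nbd G (E k) ∩ W).ncard ≤ (m2Set G x).ncard := by
    refine (Nat.le_add_right _ _).trans_eq (hdec.unmixed_iff.1 hG (E k) ?_ ?_ ?_)
    · rw [Set.disjoint_left]
      rintro v (hv | ⟨j, rfl, -⟩)
      · exact Set.disjoint_left.1 hT hv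
      · exact hdec.notMem _ _
    · rintro j ⟨h0 | ⟨j0, h0, h0'⟩, h1 | ⟨j1, h1, h1'⟩⟩
      · exact hT1 j ⟨h0, h1⟩
      · obtain ⟨rfl, rfl⟩ := hdec.eq_iff.1 h1
        exact h1'.1 h0
      · obtain ⟨rfl, rfl⟩ := hdec.eq_iff.1 h0
        exact h0'.2.1 h1
      · exact absurd ((hdec.eq_iff.1 h0).2.trans (hdec.eq_iff.1 h1).2.symm) (by decide)
    · rintro v (hv | ⟨j, -, -, -, hv⟩)
      · exact hT2 v hv
      · exact hv
  have hcover : W0 G W ⊆ (nbd G (E 0) ∩ W) ∪ (nbd G (E 1) ∩ W) ∪ INSet G W T := by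
    intro w hw
    by_cases hwT : w ∈ nbd G T
    · obtain ⟨u, hu, hadj⟩ := hwT
      exact Or.inl (Or.inl ⟨⟨u, Or.inl hu, hadj⟩, hw.1⟩)
    by_cases hwI : ∀ u, G.Adj w u → u ∈ cnbd G T
    · refine Or.inr ⟨hw, ?_, hwI⟩
      rintro (h | h)
      · exact Set.disjoint_left.1 hT h hw.1
      · exact hwT h
    push Not at hwI
    obtain ⟨u, hadj, hu⟩ := hwI
    have huW : u ∉ W := fun h => hdec.2.2.1 w hw.1 u h hadj
    obtain ⟨j, k, rfl⟩ := hdec.exists_eq huW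
    have hu1 : x j k ∉ T := fun h => hu (Or.inl h)
    have hu2 : x j (k + 1) ∉ T := fun h => hu (Or.inr ((hdec.mem_nbd_iff hT).2 h))
    have hdeg := hdec.two_le_deg_iff.2 ⟨w, hw.1, hadj.symm⟩
    left
    fin_cases k
    · exact Or.inl ⟨⟨_, Or.inr ⟨j, rfl, hu1, hu2, hdeg⟩, hadj.symm⟩, hw.1⟩
    · exact Or.inr ⟨⟨_, Or.inr ⟨j, rfl, hu2, hu1, hdeg⟩, hadj.symm⟩, hw.1⟩
  have hinter : nbd G T ∩ W ⊆ (nbd G (E 0) ∩ W) ∩ (nbd G (E 1) ∩ W) := by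
    rintro w ⟨⟨u, hu, hadj⟩, hw⟩
    exact ⟨⟨⟨u, Or.inl hu, hadj⟩, hw⟩, ⟨⟨u, Or.inl hu, hadj⟩, hw⟩⟩
  have h1 := (Set.ncard_le_ncard hcover (Set.toFinite _)).trans (Set.ncard_union_le _ _)
  have h2 := Set.ncard_le_ncard hinter (Set.toFinite _)
  have h3 := Set.ncard_union_add_ncard_inter (nbd G (E 0) ∩ W) (nbd G (E 1) ∩ W)
    (Set.toFinite _) (Set.toFinite _)
  have h4 := hE 0
  have h5 := hE 1
  omega

end IsDimDecomp

/-- a finite simple graph `G` with a dominating induced matching — given by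
an (arbitrary) decomposition `V = W ⊔ M` — is unmixed if and only if every admissible
subset `M₂ ⊆ M` (at most one vertex from each matching edge, all of degree `≥ 2`)
satisfies
`(♭1)  m₂ − m₂' = #N_G(M₂) − #M₂` and
`(♭2)  #W₀ ≤ 2·m₂ − #N_G(M₂) + #M₂ + #IN_G(M₂, W)`. -/
theorem unmixed_iff_flat_condition {V : Type*} [Fintype V] [DecidableEq V]
    (G : SimpleGraph V) (W : Set V) {m : ℕ} (x : Fin m → Fin 2 → V)
    (hdec : IsDimDecomp G W x) :
    Unmixed G ↔
      ∀ M₂ : Set V, M₂ ⊆ {v | ∃ j k, v = x j k} →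
        (∀ j : Fin m, ¬(x j 0 ∈ M₂ ∧ x j 1 ∈ M₂)) →
        (∀ v ∈ M₂, 2 ≤ deg G v) →
        (((m2Set G x).ncard : ℤ) - ((m2Set' G x M₂).ncard : ℤ) =
            ((nbd G M₂).ncard : ℤ) - (M₂.ncard : ℤ)) ∧
        (((W0 G W).ncard : ℤ) ≤
            2 * ((m2Set G x).ncard : ℤ) - ((nbd G M₂).ncard : ℤ) + (M₂.ncard : ℤ) +
              ((INSet G W M₂).ncard : ℤ)) := by
  constructor
  · intro hG T hTM hT1 hT2
    have hT : Disjoint T W := Set.disjoint_left.2 fun v hv => by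
      obtain ⟨j, k, rfl⟩ := hTM hv
      exact hdec.notMem j k
    have e1 := hdec.unmixed_iff.1 hG T hT hT1 hT2
    have e2 := hdec.ncard_nbd hT hT1
    have e3 := hdec.ncard_W0_add_le hG hT hT1 hT2
    omega
  · intro h
    refine hdec.unmixed_iff.2 fun T hT hT1 hT2 => ?_
    have e1 := (h T (fun v hv => hdec.exists_eq (Set.disjoint_left.1 hT hv)) hT1 hT2).1
    have e2 := hdec.ncard_nbd hT hT1
    omega

end DIM
end
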